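/- Let 1 ≤ p2 < p1 ≤ ∞ and let n, N ∈ ℕ with n ≤ N. Then the n-th Kolmogorov number of the identity map satisfies the exact equality d_n(id : ℓ_{p1}^N → ℓ_{p2}^N) = (N − n + 1)^{1/p2 − 1/p1}. -/

import Mathlib

open scoped ENNReal Classical

/-- The `ℓ_p` norm on `ℂ^N`, for `p ∈ [1, ∞]` (`p = ∞` gives the sup-norm). -/
noncomputable def lpNorm (p : ℝ≥0∞) {N : ℕ} (x : Fin N → ℂ) : ℝ :=
  if p = ∞ then ⨆ i, ‖x i‖ else (∑ i, ‖x i‖ ^ p.toReal) ^ (1 / p.toReal)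

/-- The `n`-th Kolmogorov number of the identity map `id : ℓ_{p1}^N → ℓ_{p2}^N`:
the infimum, over all linear subspaces `L` of `ℓ_{p2}^N` of dimension `< n`, of
`sup_{‖x‖_{p1} ≤ 1} inf_{y ∈ L} ‖x - y‖_{p2}`. -/
noncomputable def kolmogorovLp (p1 p2 : ℝ≥0∞) (N n : ℕ) : ℝ :=
  sInf { r : ℝ | ∃ L : Submodule ℂ (Fin N → ℂ), Module.finrank ℂ L < n ∧
    r = sSup { t : ℝ | ∃ x : Fin N → ℂ, lpNorm p1 x ≤ 1 ∧
      t = sInf { s : ℝ | ∃ y ∈ L, s = lpNorm p2 (x - y) } } }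

/-- If fewer than `finrank M` coordinates of `z ∈ M` have modulus one, then `z` can be moved inside
the unit ball of `M ∩ ℓ_∞` until one more coordinate has modulus one. -/
lemma exists_mem_card_norm_eq_one_lt {N : ℕ} (M : Submodule ℂ (Fin N → ℂ)) {z : Fin N → ℂ}
    (hzM : z ∈ M) (hz : ∀ i, ‖z i‖ ≤ 1)
    (hcard : (Finset.univ.filter fun i => ‖z i‖ = 1).card < Module.finrank ℂ M) :
    ∃ z' ∈ M, (∀ i, ‖z' i‖ ≤ 1) ∧ (Finset.univ.filter fun i => ‖z i‖ = 1).card <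
      (Finset.univ.filter fun i => ‖z' i‖ = 1).card := by
  set S := Finset.univ.filter fun i => ‖z i‖ = 1 with hS
  let restr : M →ₗ[ℂ] (S → ℂ) := (LinearMap.funLeft ℂ ℂ (Subtype.val : S → Fin N)) ∘ₗ M.subtype
  have hker : LinearMap.ker restr ≠ ⊥ := by
    apply LinearMap.ker_ne_bot_of_finrank_lt
    simpa using hcard
  obtain ⟨⟨w, hwM⟩, hwker, hw0⟩ := Submodule.exists_mem_ne_zero_of_ne_bot hker
  have hwS : ∀ i ∈ S, w i = 0 := fun i hi => congrFun (LinearMap.mem_ker.1 hwker) ⟨i, hi⟩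
  have hw0 : w ≠ 0 := fun h => hw0 (by simpa using h)
  obtain ⟨j, hj⟩ := Function.ne_iff.1 hw0
  have hj : w j ≠ 0 := hj
  have hjS : j ∉ S := fun h => hj (hwS j h)
  let g : ℝ → ℝ := fun t => ‖fun i : {i // i ∉ S} => z i + (t : ℂ) * w i‖
  have hg : Continuous g := by
    unfold g
    fun_prop
  have hg0 : g 0 ≤ 1 := by
    refine (pi_norm_le_iff_of_nonneg zero_le_one).2 fun i => ?_
    simpa using hz i
  have hgT : 1 ≤ g (2 / ‖w j‖) := by
    have h1 : ‖z j + ((2 / ‖w j‖ : ℝ) : ℂ) * w j‖ ≤ g (2 / ‖w j‖) :=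
      norm_le_pi_norm (fun i : {i // i ∉ S} => z i + ((2 / ‖w j‖ : ℝ) : ℂ) * w i) ⟨j, hjS⟩
    have h2 : ‖((2 / ‖w j‖ : ℝ) : ℂ) * w j‖ = 2 := by
      have : ‖w j‖ ≠ 0 := norm_ne_zero_iff.2 hj
      rw [norm_mul, Complex.norm_real, Real.norm_of_nonneg (by positivity)]
      field_simp
    have h3 := norm_sub_le (z j + ((2 / ‖w j‖ : ℝ) : ℂ) * w j) (z j)
    rw [add_sub_cancel_left, h2] at h3
    linarith [hz j]
  obtain ⟨t, -, ht⟩ := intermediate_value_Icc (by positivity) hg.continuousOn ⟨hg0, hgT⟩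
  have hle : ∀ i ∉ S, ‖z i + (t : ℂ) * w i‖ ≤ 1 := fun i hi =>
    ht ▸ norm_le_pi_norm (fun i : {i // i ∉ S} => z i + (t : ℂ) * w i) ⟨i, hi⟩
  obtain ⟨k, hkS, hk⟩ : ∃ k ∉ S, ‖z k + (t : ℂ) * w k‖ = 1 := by
    by_contra! hne
    refine ht.not_lt ((pi_norm_lt_iff zero_lt_one).2 fun i => ?_)
    exact lt_of_le_of_ne (hle i i.2) (hne i i.2)
  refine ⟨z + (t : ℂ) • w, M.add_mem hzM (M.smul_mem _ hwM), fun i => ?_, ?_⟩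
  · by_cases hi : i ∈ S
    · simpa [hwS i hi] using hz i
    · simpa using hle i hi
  · refine Finset.card_lt_card (Finset.ssubset_iff_of_subset (fun i hi => ?_) |>.2 ⟨k, ?_, hkS⟩)
    · have := (Finset.mem_filter.1 hi).2
      simpa [hwS i hi] using this
    · simpa using hk

/-- A subspace `M` of `ℂ^N` contains a vector of sup-norm at most one with at least `finrank M`
coordinates of modulus one. -/
lemma exists_mem_finrank_le_card_norm_eq_one {N : ℕ} (M : Submodule ℂ (Fin N → ℂ)) :
    ∃ z ∈ M, (∀ i, ‖z i‖ ≤ 1) ∧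
      Module.finrank ℂ M ≤ (Finset.univ.filter fun i => ‖z i‖ = 1).card := by
  suffices h : ∀ k ≤ Module.finrank ℂ M, ∃ z ∈ M, (∀ i, ‖z i‖ ≤ 1) ∧
      k ≤ (Finset.univ.filter fun i => ‖z i‖ = 1).card from h _ le_rfl
  intro k
  induction k with
  | zero => exact fun _ => ⟨0, M.zero_mem, by simp, Nat.zero_le _⟩
  | succ k ih =>
    intro hk
    obtain ⟨z, hzM, hz, hkz⟩ := ih (by omega)
    by_cases hlt : (Finset.univ.filter fun i => ‖z i‖ = 1).card < Module.finrank ℂ M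
    · obtain ⟨z', hz'M, hz', hcard⟩ := exists_mem_card_norm_eq_one_lt M hzM hz hlt
      exact ⟨z', hz'M, hz', by omega⟩
    · exact ⟨z, hzM, hz, by omega⟩

/-- The annihilator of `L ≤ ℂ^N` under the bilinear dot product has dimension at least
`N - finrank L`. -/
lemma exists_submodule_dotProduct_eq_zero {N : ℕ} (L : Submodule ℂ (Fin N → ℂ)) :
    ∃ M : Submodule ℂ (Fin N → ℂ), N ≤ Module.finrank ℂ L + Module.finrank ℂ M ∧
      ∀ z ∈ M, ∀ y ∈ L, ∑ i, y i * z i = 0 := by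
  let φ : (Fin N → ℂ) →ₗ[ℂ] Module.Dual ℂ L :=
    L.subtype.dualMap ∘ₗ (dotProductBilin ℂ ℂ : (Fin N → ℂ) →ₗ[ℂ] (Fin N → ℂ) →ₗ[ℂ] ℂ)
  refine ⟨LinearMap.ker φ, ?_, fun z hz y hy => ?_⟩
  · have h1 := φ.finrank_range_add_finrank_ker
    have h2 := Submodule.finrank_le (LinearMap.range φ)
    rw [Subspace.dual_finrank_eq] at h2
    rw [Module.finrank_fin_fun] at h1
    omega
  · have h : z ⬝ᵥ y = 0 := DFunLike.congr_fun (LinearMap.mem_ker.1 hz) (⟨y, hy⟩ : L)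
    simpa [dotProduct, mul_comm] using h

lemma lpNorm_nonneg (p : ℝ≥0∞) {N : ℕ} (x : Fin N → ℂ) : 0 ≤ lpNorm p x := by
  unfold lpNorm
  split_ifs
  · exact Real.iSup_nonneg fun i => norm_nonneg _
  · positivity

lemma lpNorm_top_le_one_iff {N : ℕ} (x : Fin N → ℂ) : lpNorm ∞ x ≤ 1 ↔ ∀ i, ‖x i‖ ≤ 1 := by
  rw [lpNorm, if_pos rfl]
  exact ⟨fun h i => (le_ciSup (Set.finite_range _).bddAbove i).trans h,
    fun h => Real.iSup_le h zero_le_one⟩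

lemma lpNorm_le_one_iff {p : ℝ≥0∞} (hp0 : 0 < p.toReal) {N : ℕ} (x : Fin N → ℂ) :
    lpNorm p x ≤ 1 ↔ ∑ i, ‖x i‖ ^ p.toReal ≤ 1 := by
  have hp : p ≠ ∞ := fun h => by simp [h] at hp0
  have h0 : 0 ≤ ∑ i, ‖x i‖ ^ p.toReal := by positivity
  have h := Real.rpow_le_rpow_iff h0 zero_le_one (one_div_pos.2 hp0)
  rw [Real.one_rpow] at h
  rwa [lpNorm, if_neg hp]

/-- Comparison of `ℓ_{p2}` and `ℓ_{p1}` norms on a set of coordinates, for `p2 < p1`. -/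
lemma rpow_sum_le_card_rpow {p1 p2 : ℝ≥0∞} (hp2 : 1 ≤ p2) (hp21 : p2 < p1) {N : ℕ}
    (J : Finset (Fin N)) {x : Fin N → ℂ} (hx : lpNorm p1 x ≤ 1) :
    (∑ i ∈ J, ‖x i‖ ^ p2.toReal) ^ (1 / p2.toReal) ≤
      (J.card : ℝ) ^ (1 / p2.toReal - 1 / p1.toReal) := by
  have hp2top : p2 ≠ ∞ := hp21.ne_top
  have hP : 1 ≤ p2.toReal := by simpa using ENNReal.toReal_mono hp2top hp2
  have hP0 : 0 < p2.toReal := by linarith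
  rcases eq_or_ne p1 ∞ with rfl | hp1top
  · rw [lpNorm_top_le_one_iff] at hx
    simp only [ENNReal.toReal_top, div_zero, sub_zero]
    gcongr
    calc ∑ i ∈ J, ‖x i‖ ^ p2.toReal ≤ ∑ i ∈ J, (1 : ℝ) :=
          Finset.sum_le_sum fun i _ => Real.rpow_le_one (norm_nonneg _) (hx i) hP0.le
      _ = J.card := by simp
  · have hPQ : p2.toReal < p1.toReal := ENNReal.toReal_strict_mono hp1top hp21
    have hQ0 : 0 < p1.toReal := by linarith
    rw [lpNorm_le_one_iff hQ0] at hx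
    have hratio : 1 ≤ p1.toReal / p2.toReal := (one_le_div hP0).2 hPQ.le
    have hmean := Real.inner_le_weight_mul_Lp_of_nonneg J hratio (fun _ => (1 : ℝ))
      (fun i => ‖x i‖ ^ p2.toReal) (fun _ => zero_le_one) (fun i => by positivity)
    have hsum : ∑ i ∈ J, (‖x i‖ ^ p2.toReal) ^ (p1.toReal / p2.toReal) ≤ 1 := by
      refine le_trans ?_ hx
      calc ∑ i ∈ J, (‖x i‖ ^ p2.toReal) ^ (p1.toReal / p2.toReal)
          = ∑ i ∈ J, ‖x i‖ ^ p1.toReal := by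
            refine Finset.sum_congr rfl fun i _ => ?_
            rw [← Real.rpow_mul (norm_nonneg _), mul_div_cancel₀ _ hP0.ne']
        _ ≤ ∑ i, ‖x i‖ ^ p1.toReal :=
            Finset.sum_le_sum_of_subset_of_nonneg (Finset.subset_univ _)
              fun i _ _ => by positivity
    simp only [one_mul, Finset.sum_const, nsmul_eq_mul, mul_one] at hmean
    have hbound : ∑ i ∈ J, ‖x i‖ ^ p2.toReal ≤
        (J.card : ℝ) ^ (1 - (p1.toReal / p2.toReal)⁻¹) :=
      hmean.trans (mul_le_of_le_one_right (by positivity)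
        (Real.rpow_le_one (by positivity) hsum (by positivity)))
    calc (∑ i ∈ J, ‖x i‖ ^ p2.toReal) ^ (1 / p2.toReal)
        ≤ ((J.card : ℝ) ^ (1 - (p1.toReal / p2.toReal)⁻¹)) ^ (1 / p2.toReal) := by
          gcongr
      _ = (J.card : ℝ) ^ (1 / p2.toReal - 1 / p1.toReal) := by
          rw [← Real.rpow_mul (by positivity)]
          congr 1
          field_simp

/-- Hölder's inequality against a vector with entries in the unit disc; the exponent `r` only has to
be at most the conjugate exponent of `p`. -/
lemma norm_sum_mul_le_of_norm_le_one {p r : ℝ} (hp : 1 ≤ p) (hr0 : 0 < r)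
    (hr : 0 ≤ r + p * (1 - r)) {N : ℕ} (v z : Fin N → ℂ) (hz : ∀ i, ‖z i‖ ≤ 1) :
    ‖∑ i, v i * z i‖ ≤ (∑ i, ‖z i‖ ^ r) ^ (1 - 1 / p) * (∑ i, ‖v i‖ ^ p) ^ (1 / p) := by
  have hp0 : 0 < p := by linarith
  have hmean := Real.inner_le_weight_mul_Lp_of_nonneg Finset.univ hp (fun i => ‖z i‖ ^ r)
    (fun i => ‖v i‖ * ‖z i‖ ^ (1 - r)) (fun i => by positivity) (fun i => by positivity)
  simp only [← one_div] at hmean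
  have hleft : ∀ i, ‖v i * z i‖ = ‖z i‖ ^ r * (‖v i‖ * ‖z i‖ ^ (1 - r)) := by
    intro i
    rcases (norm_nonneg (z i)).eq_or_lt with h0 | hpos
    · rw [norm_mul, ← h0, Real.zero_rpow hr0.ne']
      simp
    · rw [norm_mul, mul_left_comm, ← Real.rpow_add hpos, add_sub_cancel, Real.rpow_one]
  have hright : ∀ i, ‖z i‖ ^ r * (‖v i‖ * ‖z i‖ ^ (1 - r)) ^ p ≤ ‖v i‖ ^ p := by
    intro i
    rcases (norm_nonneg (z i)).eq_or_lt with h0 | hpos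
    · rw [← h0, Real.zero_rpow hr0.ne', zero_mul]
      positivity
    · rw [Real.mul_rpow (norm_nonneg _) (by positivity), mul_left_comm, ← Real.rpow_mul hpos.le,
        ← Real.rpow_add hpos]
      refine mul_le_of_le_one_right (by positivity) (Real.rpow_le_one hpos.le (hz i) ?_)
      linarith
  calc ‖∑ i, v i * z i‖ ≤ ∑ i, ‖v i * z i‖ := norm_sum_le _ _
    _ = ∑ i, ‖z i‖ ^ r * (‖v i‖ * ‖z i‖ ^ (1 - r)) := Finset.sum_congr rfl fun i _ => hleft i
    _ ≤ _ := hmean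
    _ ≤ _ := by
      gcongr with i
      exact hright i

/-- The vector in the unit ball of `ℓ_p` at which a nonzero functional `z` attains its norm, with `r`
the conjugate exponent of `p`. -/
lemma exists_lpNorm_le_one_sum_mul_eq {p : ℝ≥0∞} (hp : 1 < p) {r : ℝ} (hr1 : 1 ≤ r)
    (hr : r * (1 - 1 / p.toReal) = 1) {N : ℕ} (z : Fin N → ℂ) (hz : 0 < ∑ i, ‖z i‖ ^ r) :
    ∃ x : Fin N → ℂ, lpNorm p x ≤ 1 ∧
      ∑ i, x i * z i = (((∑ i, ‖z i‖ ^ r) ^ (1 - 1 / p.toReal) : ℝ) : ℂ) := by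
  set A := ∑ i, ‖z i‖ ^ r with hA
  have hunit : ∀ i, ∃ u : ℂ, ‖u‖ = 1 ∧ u * z i = (‖z i‖ : ℂ) := by
    intro i
    by_cases h : z i = 0
    · exact ⟨1, by simp, by simp [h]⟩
    · have h' : ‖z i‖ ≠ 0 := norm_ne_zero_iff.2 h
      refine ⟨(‖z i‖ : ℂ) / z i, ?_, div_mul_cancel₀ _ h⟩
      rw [norm_div, Complex.norm_real, norm_norm, div_self h']
  choose u hu huz using hunit
  refine ⟨fun i => ((A ^ (-(1 / p.toReal)) * ‖z i‖ ^ (r - 1) : ℝ) : ℂ) * u i, ?_, ?_⟩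
  · have hnorm : ∀ i, ‖((A ^ (-(1 / p.toReal)) * ‖z i‖ ^ (r - 1) : ℝ) : ℂ) * u i‖ =
        A ^ (-(1 / p.toReal)) * ‖z i‖ ^ (r - 1) := by
      intro i
      rw [norm_mul, hu, mul_one, Complex.norm_real, Real.norm_of_nonneg (by positivity)]
    rcases eq_or_ne p ∞ with rfl | hptop
    · have hr1 : r = 1 := by simpa using hr
      rw [lpNorm_top_le_one_iff]
      intro i
      rw [hnorm, hr1]
      simp
    · have hp0 : 0 < p.toReal := ENNReal.toReal_pos (zero_lt_one.trans hp).ne' hptop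
      rw [lpNorm_le_one_iff hp0]
      have hexp : (r - 1) * p.toReal = r := by
        field_simp at hr
        linarith
      have hterm : ∀ i, ‖((A ^ (-(1 / p.toReal)) * ‖z i‖ ^ (r - 1) : ℝ) : ℂ) * u i‖ ^ p.toReal =
          A⁻¹ * ‖z i‖ ^ r := by
        intro i
        rw [hnorm, Real.mul_rpow (by positivity) (by positivity), ← Real.rpow_mul hz.le,
          ← Real.rpow_mul (norm_nonneg _), hexp, neg_mul, one_div_mul_cancel hp0.ne',
          Real.rpow_neg_one]
      rw [Finset.sum_congr rfl fun i _ => hterm i, ← Finset.mul_sum, ← hA,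
        inv_mul_cancel₀ hz.ne']
  · have hterm : ∀ i, ((A ^ (-(1 / p.toReal)) * ‖z i‖ ^ (r - 1) : ℝ) : ℂ) * u i * z i =
        ((A ^ (-(1 / p.toReal)) * ‖z i‖ ^ r : ℝ) : ℂ) := by
      intro i
      have hpow : ‖z i‖ ^ r = ‖z i‖ ^ (r - 1) * ‖z i‖ := by
        have hne : r - 1 + 1 ≠ 0 := by linarith
        conv_lhs => rw [← sub_add_cancel r 1]
        rw [Real.rpow_add' (norm_nonneg _) hne, Real.rpow_one]
      rw [mul_assoc, huz, hpow]
      push_cast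
      ring
    rw [Finset.sum_congr rfl fun i _ => hterm i, ← Complex.ofReal_sum, ← Finset.mul_sum, ← hA,
      sub_eq_neg_add, Real.rpow_add hz, Real.rpow_one]

/-- Every subspace of dimension less than `n` has `ℓ_{p2}` distance at least
`(N - n + 1)^(1/p2 - 1/p1)` from some vector of the unit ball of `ℓ_{p1}^N`. -/
lemma exists_lpNorm_le_one_forall_le_lpNorm_sub {p1 p2 : ℝ≥0∞} (hp2 : 1 ≤ p2) (hp21 : p2 < p1)
    {n N : ℕ} (hnN : n ≤ N) (L : Submodule ℂ (Fin N → ℂ)) (hL : Module.finrank ℂ L < n) :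
    ∃ x : Fin N → ℂ, lpNorm p1 x ≤ 1 ∧ ∀ y ∈ L,
      ((N : ℝ) - (n : ℝ) + 1) ^ (1 / p2.toReal - 1 / p1.toReal) ≤ lpNorm p2 (x - y) := by
  have hp2top : p2 ≠ ∞ := hp21.ne_top
  have hP : 1 ≤ p2.toReal := by simpa using ENNReal.toReal_mono hp2top hp2
  have hP0 : 0 < p2.toReal := by linarith
  have hθ0 : 0 ≤ 1 / p1.toReal := by positivity
  have hθ : 1 / p1.toReal < 1 / p2.toReal := by
    rcases eq_or_ne p1 ∞ with rfl | hp1top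
    · simpa using hP0
    · exact one_div_lt_one_div_of_lt hP0 (ENNReal.toReal_strict_mono hp1top hp21)
  have hP1 : 1 / p2.toReal ≤ 1 := (div_le_one hP0).2 hP
  set r : ℝ := (1 - 1 / p1.toReal)⁻¹ with hr
  have hden : 0 < 1 - 1 / p1.toReal := by linarith
  have hr0 : 0 < r := inv_pos.2 hden
  have hr1 : 1 ≤ r := (one_le_inv₀ hden).2 (by linarith)
  have hrmul : r * (1 - 1 / p1.toReal) = 1 := inv_mul_cancel₀ hden.ne'
  have hrP : 0 ≤ r + p2.toReal * (1 - r) := by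
    have h1 : 1 - r = -(r * (1 / p1.toReal)) := by linarith
    have h2 : p2.toReal * (1 / p1.toReal) ≤ 1 := by
      calc p2.toReal * (1 / p1.toReal) ≤ p2.toReal * (1 / p2.toReal) := by gcongr
        _ = 1 := mul_one_div_cancel hP0.ne'
    rw [h1]
    nlinarith
  obtain ⟨M, hM, hLM⟩ := exists_submodule_dotProduct_eq_zero L
  obtain ⟨z, hzM, hz, hcard⟩ := exists_mem_finrank_le_card_norm_eq_one M
  have hmpos : (0 : ℝ) < (N : ℝ) - n + 1 := by
    have : (n : ℝ) ≤ N := by exact_mod_cast hnN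
    linarith
  have hmA : (N : ℝ) - n + 1 ≤ ∑ i, ‖z i‖ ^ r := by
    calc (N : ℝ) - n + 1 ≤ ((Finset.univ.filter fun i => ‖z i‖ = 1).card : ℝ) := by
          have : N + 1 ≤ (Finset.univ.filter fun i => ‖z i‖ = 1).card + n := by omega
          have : (N : ℝ) + 1 ≤ (Finset.univ.filter fun i => ‖z i‖ = 1).card + n := by
            exact_mod_cast this
          linarith
      _ = ∑ i ∈ Finset.univ.filter (fun i => ‖z i‖ = 1), ‖z i‖ ^ r := by
          rw [Finset.cast_card]
          refine Finset.sum_congr rfl fun i hi => ?_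
          rw [(Finset.mem_filter.1 hi).2, Real.one_rpow]
      _ ≤ ∑ i, ‖z i‖ ^ r :=
          Finset.sum_le_sum_of_subset_of_nonneg (Finset.subset_univ _) fun i _ _ => by positivity
  have hA : 0 < ∑ i, ‖z i‖ ^ r := hmpos.trans_le hmA
  obtain ⟨x, hx, hxz⟩ := exists_lpNorm_le_one_sum_mul_eq (hp2.trans_lt hp21) hr1 hrmul z hA
  refine ⟨x, hx, fun y hy => ?_⟩
  set A := ∑ i, ‖z i‖ ^ r
  have hpair : ∑ i, (x - y) i * z i = ((A ^ (1 - 1 / p1.toReal) : ℝ) : ℂ) := by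
    simp only [Pi.sub_apply, sub_mul, Finset.sum_sub_distrib]
    rw [hLM z hzM y hy, sub_zero, hxz]
  have hholder := norm_sum_mul_le_of_norm_le_one hP hr0 hrP (x - y) z hz
  rw [hpair, Complex.norm_real, Real.norm_of_nonneg (by positivity)] at hholder
  have hlp : lpNorm p2 (x - y) = (∑ i, ‖(x - y) i‖ ^ p2.toReal) ^ (1 / p2.toReal) := by
    rw [lpNorm, if_neg hp2top]
  rw [← hlp] at hholder
  calc ((N : ℝ) - n + 1) ^ (1 / p2.toReal - 1 / p1.toReal)
      ≤ A ^ (1 / p2.toReal - 1 / p1.toReal) :=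
        Real.rpow_le_rpow hmpos.le hmA (by linarith)
    _ = A ^ (1 - 1 / p1.toReal) / A ^ (1 - 1 / p2.toReal) := by
        rw [← Real.rpow_sub hA]
        congr 1
        ring
    _ ≤ lpNorm p2 (x - y) := by
        rw [div_le_iff₀ (by positivity), mul_comm]
        exact hholder

/-- There is a (coordinate) subspace of dimension `n - 1` whose `ℓ_{p2}` distance from every vector of
the unit ball of `ℓ_{p1}^N` is at most `(N - n + 1)^(1/p2 - 1/p1)`. -/
lemma exists_submodule_forall_exists_lpNorm_sub_le {p1 p2 : ℝ≥0∞} (hp2 : 1 ≤ p2) (hp21 : p2 < p1)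
    {n N : ℕ} (hn : 1 ≤ n) (hnN : n ≤ N) :
    ∃ L : Submodule ℂ (Fin N → ℂ), Module.finrank ℂ L < n ∧ ∀ x : Fin N → ℂ, lpNorm p1 x ≤ 1 →
      ∃ y ∈ L, lpNorm p2 (x - y) ≤
        ((N : ℝ) - (n : ℝ) + 1) ^ (1 / p2.toReal - 1 / p1.toReal) := by
  have hp2top : p2 ≠ ∞ := hp21.ne_top
  have hP : 1 ≤ p2.toReal := by simpa using ENNReal.toReal_mono hp2top hp2
  have hP0 : p2.toReal ≠ 0 := by linarith
  obtain ⟨K, hK⟩ : ∃ K : Finset (Fin N), K.card = n - 1 := by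
    obtain ⟨K, -, hK⟩ := Finset.exists_subset_card_eq
      (s := (Finset.univ : Finset (Fin N))) (n := n - 1) (by simp; omega)
    exact ⟨K, hK⟩
  let extend : (K → ℂ) →ₗ[ℂ] (Fin N → ℂ) := Function.ExtendByZero.linearMap ℂ (Subtype.val)
  refine ⟨LinearMap.range extend, ?_, fun x hx => ⟨extend fun i => x i, ⟨_, rfl⟩, ?_⟩⟩
  · have := LinearMap.finrank_range_le extend
    simp only [Module.finrank_fintype_fun_eq_card, Fintype.card_coe] at this
    omega
  · have hin : ∀ i ∈ K, (x - extend fun i => x i) i = 0 := by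
      intro i hi
      have : extend (fun i => x i) i = x i :=
        Subtype.val_injective.extend_apply (fun i : K => x i) (0 : Fin N → ℂ) ⟨i, hi⟩
      simp [this]
    have hout : ∀ i ∉ K, (x - extend fun i => x i) i = x i := by
      intro i hi
      have : extend (fun i => x i) i = 0 :=
        Function.extend_apply' (fun i : K => x i) (0 : Fin N → ℂ) i fun ⟨k, hk⟩ => hi (hk ▸ k.2)
      simp [this]
    have hsum : ∑ i, ‖(x - extend fun i => x i) i‖ ^ p2.toReal =
        ∑ i ∈ Kᶜ, ‖x i‖ ^ p2.toReal := by
      rw [← Finset.sum_add_sum_compl K, Finset.sum_eq_zero, zero_add]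
      · exact Finset.sum_congr rfl fun i hi => by rw [hout i (Finset.mem_compl.1 hi)]
      · intro i hi
        rw [hin i hi, norm_zero, Real.zero_rpow hP0]
    have hcard : (Kᶜ.card : ℝ) = (N : ℝ) - n + 1 := by
      rw [Finset.card_compl, hK, Fintype.card_fin, Nat.cast_sub (by omega), Nat.cast_sub hn]
      push_cast
      ring
    rw [lpNorm, if_neg hp2top, hsum, ← hcard]
    exact rpow_sum_le_card_rpow hp2 hp21 _ hx

/-- Let `1 ≤ p2 < p1 ≤ ∞` and `n ≤ N`. Then
`d_n(id : ℓ_{p1}^N → ℓ_{p2}^N) = (N - n + 1)^{1/p2 - 1/p1}` (with `1/∞` read as `0`). -/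
theorem kolmogorov_id_lp_decreasing (p1 p2 : ℝ≥0∞) (hp2 : 1 ≤ p2) (hp21 : p2 < p1)
    (n N : ℕ) (hn : 1 ≤ n) (hnN : n ≤ N) :
    kolmogorovLp p1 p2 N n = ((N : ℝ) - (n : ℝ) + 1) ^ (1 / p2.toReal - 1 / p1.toReal) := by
  have hdist_le : ∀ (L : Submodule ℂ (Fin N → ℂ)) (x : Fin N → ℂ), ∀ y ∈ L,
      sInf { s : ℝ | ∃ y ∈ L, s = lpNorm p2 (x - y) } ≤ lpNorm p2 (x - y) := by
    intro L x y hy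
    refine csInf_le ⟨0, ?_⟩ ⟨y, hy, rfl⟩
    rintro _ ⟨y', -, rfl⟩
    exact lpNorm_nonneg _ _
  have hlower : ∀ L : Submodule ℂ (Fin N → ℂ), Module.finrank ℂ L < n →
      ((N : ℝ) - (n : ℝ) + 1) ^ (1 / p2.toReal - 1 / p1.toReal) ≤
        sSup { t : ℝ | ∃ x : Fin N → ℂ, lpNorm p1 x ≤ 1 ∧
          t = sInf { s : ℝ | ∃ y ∈ L, s = lpNorm p2 (x - y) } } := by
    intro L hL
    obtain ⟨x, hx, hxL⟩ := exists_lpNorm_le_one_forall_le_lpNorm_sub hp2 hp21 hnN L hL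
    refine le_csSup_of_le ?_ ⟨x, hx, rfl⟩ ?_
    · refine ⟨((Finset.univ : Finset (Fin N)).card : ℝ) ^ (1 / p2.toReal - 1 / p1.toReal), ?_⟩
      rintro _ ⟨x', hx', rfl⟩
      refine (hdist_le L x' 0 L.zero_mem).trans ?_
      rw [sub_zero, lpNorm, if_neg hp21.ne_top]
      exact rpow_sum_le_card_rpow hp2 hp21 _ hx'
    · refine le_csInf ⟨_, 0, L.zero_mem, rfl⟩ ?_
      rintro _ ⟨y, hy, rfl⟩
      exact hxL y hy
  obtain ⟨L, hL, hLx⟩ := exists_submodule_forall_exists_lpNorm_sub_le hp2 hp21 hn hnN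
  have hbase : (0 : ℝ) ≤ (N : ℝ) - n + 1 := by
    have : (n : ℝ) ≤ N := by exact_mod_cast hnN
    linarith
  unfold kolmogorovLp
  apply le_antisymm
  · refine csInf_le_of_le ⟨((N : ℝ) - n + 1) ^ (1 / p2.toReal - 1 / p1.toReal), ?_⟩
      ⟨L, hL, rfl⟩ ?_
    · rintro _ ⟨L', hL', rfl⟩
      exact hlower L' hL'
    · refine Real.sSup_le ?_ (by positivity)
      rintro _ ⟨x, hx, rfl⟩
      obtain ⟨y, hy, hxy⟩ := hLx x hx
      exact (hdist_le L x y hy).trans hxy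
  · refine le_csInf ⟨_, L, hL, rfl⟩ ?_
    rintro _ ⟨L', hL', rfl⟩
    exact hlower L' hL'
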